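/- arXiv:2504.16205 — 2 statements merged into one kernel-verified Lean document; each statement's English description precedes it below -/
import Mathlib

section
/- Let m ≥ 3 and let a, b ∈ ZMod m be nonzero with 2a ≠ 0, 2b ≠ 0, a ≠ b and a ≠ −b, and suppose the I-graph G = I(m;a,b) is connected. Then every Hamilton cycle C of G satisfies at least one of the following: (i) C contains every spoke u_i v_i for all i ∈ ZMod m (C is alternating); (ii) there exists t ∈ ZMod m such that C contains the four edges u_t u_{t+a}, u_{t+b} u_{t+a+b}, v_t v_{t+b} and v_{t+a} v_{t+a+b} (C is 4-hooked); (iii) there exists t ∈ ZMod m such that G contains a Hamilton path with endpoints v_t and v_{t+a}, or a Hamilton path with endpoints u_t and u_{t+b} (C is 2-hooked). -/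
open SimpleGraph

/-- The bicirculant graph `B(m;R,S,T)` on vertex set `ZMod m ⊕ ZMod m`. -/
def bicirculant (m : ℕ) (R S T : Set (ZMod m)) : SimpleGraph (ZMod m ⊕ ZMod m) :=
  SimpleGraph.fromRel (fun x y =>
    match x, y with
    | Sum.inl i, Sum.inl i' => ∃ j ∈ R, i' = i + j
    | Sum.inr i, Sum.inr i' => ∃ j ∈ T, i' = i + j
    | Sum.inl i, Sum.inr i' => ∃ j ∈ S, i' = i + j
    | Sum.inr _, Sum.inl _ => False)

/-- The I-graph `I(m;a,b) = B(m;{a,-a},{0},{b,-b})`. -/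
def Igraph (m : ℕ) (a b : ZMod m) : SimpleGraph (ZMod m ⊕ ZMod m) :=
  bicirculant m {a, -a} {0} {b, -b}

namespace SimpleGraph.Walk

variable {V : Type*} {G : SimpleGraph V} {u v w x y z : V}

/-- The walk `C` traverses the edge from `x` to `y`, in this direction. -/
def HasDart (C : G.Walk u v) (x y : V) : Prop := ∃ d ∈ C.darts, d.fst = x ∧ d.snd = y

theorem HasDart.adj {C : G.Walk u v} (h : C.HasDart x y) : G.Adj x y := by
  obtain ⟨d, -, rfl, rfl⟩ := h
  exact d.adj

theorem hasDart_reverse {C : G.Walk u v} : C.reverse.HasDart x y ↔ C.HasDart y x := by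
  constructor
  · rintro ⟨d, hd, rfl, rfl⟩
    exact ⟨d.symm, mem_darts_reverse.1 hd, rfl, rfl⟩
  · rintro ⟨d, hd, rfl, rfl⟩
    exact ⟨d.symm, mem_darts_reverse.2 (by simpa using hd), rfl, rfl⟩

theorem mem_edges_iff_hasDart {C : G.Walk u v} :
    s(x, y) ∈ C.edges ↔ C.HasDart x y ∨ C.HasDart y x := by
  simp only [edges, List.mem_map, HasDart]
  constructor
  · rintro ⟨d, hd, he⟩
    rcases Sym2.eq_iff.1 he with ⟨h1, h2⟩ | ⟨h1, h2⟩
    · exact Or.inl ⟨_, hd, h1, h2⟩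
    · exact Or.inr ⟨_, hd, h1, h2⟩
  · rintro (⟨d, hd, rfl, rfl⟩ | ⟨d, hd, rfl, rfl⟩)
    · exact ⟨d, hd, rfl⟩
    · exact ⟨d, hd, Sym2.eq_swap⟩

theorem IsCycle.hasDart_left_unique {C : G.Walk u u} (hC : C.IsCycle)
    (hx : C.HasDart x z) (hy : C.HasDart y z) : x = y := by
  obtain ⟨d, hd, rfl, rfl⟩ := hx
  obtain ⟨e, he, rfl, h⟩ := hy
  have := hC.support_nodup
  rw [← map_snd_darts] at this
  rw [List.inj_on_of_nodup_map this hd he h.symm]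

theorem IsCycle.hasDart_right_unique {C : G.Walk u u} (hC : C.IsCycle)
    (hx : C.HasDart z x) (hy : C.HasDart z y) : x = y :=
  hC.reverse.hasDart_left_unique (hasDart_reverse.2 hx) (hasDart_reverse.2 hy)

theorem IsTrail.not_hasDart_swap {C : G.Walk u v} (hC : C.IsTrail)
    (hx : C.HasDart x y) : ¬ C.HasDart y x := by
  rintro ⟨e, he, rfl, rfl⟩
  obtain ⟨d, hd, h1, h2⟩ := hx
  have hde : d = e.symm := by ext <;> simp [h1, h2]
  have := List.inj_on_of_nodup_map hC.edges_nodup hd he (by rw [hde, Dart.edge_symm])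
  exact e.adj.ne (by rw [← h2, this])

/-- A cycle containing the consecutive edges `y x`, `x z`, `z x'`, `x' y'` traverses `x y` and
`x' y'` in opposite directions. -/
theorem IsCycle.hasDart_iff_not_of_mem_edges {C : G.Walk u u} (hC : C.IsCycle)
    {x' y' : V} (hxy : s(x, y) ∈ C.edges) (hxy' : s(x', y') ∈ C.edges) (hxz : s(z, x) ∈ C.edges)
    (hxz' : s(z, x') ∈ C.edges) (hxx' : x ≠ x') (hy : y ≠ z) (hy' : y' ≠ z) :
    C.HasDart x y ↔ ¬ C.HasDart x' y' := by
  rw [mem_edges_iff_hasDart] at *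
  rcases hxz with h | h <;> rcases hxz' with h' | h'
  · exact absurd (hC.hasDart_right_unique h h') hxx'
  · have h1 : ¬ C.HasDart x' y' := fun h'' => hy' (hC.hasDart_right_unique h'' h')
    have h2 : ¬ C.HasDart y x := fun h'' => hy (hC.hasDart_left_unique h'' h)
    tauto
  · have h1 : ¬ C.HasDart x y := fun h'' => hy (hC.hasDart_right_unique h'' h)
    have h2 : ¬ C.HasDart y' x' := fun h'' => hy' (hC.hasDart_left_unique h'' h')
    tauto
  · exact absurd (hC.hasDart_left_unique h h') hxx'

theorem IsTrail.hasDart_iff_not_swap {C : G.Walk u v} (hC : C.IsTrail) (h : s(x, y) ∈ C.edges) :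
    C.HasDart x y ↔ ¬ C.HasDart y x :=
  ⟨hC.not_hasDart_swap, (mem_edges_iff_hasDart.1 h).resolve_right⟩

theorem exists_eq_append_cons_of_mem_darts (p : G.Walk u v) {d : G.Dart} (hd : d ∈ p.darts) :
    ∃ (q : G.Walk u d.fst) (r : G.Walk d.snd v), p = q.append (cons d.adj r) := by
  induction p with
  | nil => simp at hd
  | cons h p ih =>
    rw [darts_cons, List.mem_cons] at hd
    rcases hd with rfl | hd
    · exact ⟨nil, p, rfl⟩
    · obtain ⟨q, r, rfl⟩ := ih hd
      exact ⟨cons h q, r, rfl⟩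

variable [DecidableEq V]

theorem IsHamiltonianCycle.exists_hasDart_left {C : G.Walk u u} (hC : C.IsHamiltonianCycle)
    (x : V) : ∃ y, C.HasDart y x := by
  have : x ∈ C.support.tail := by
    rw [← support_tail_of_not_nil _ hC.not_nil]
    exact hC.isHamiltonian_tail.mem_support x
  rw [← map_snd_darts, List.mem_map] at this
  obtain ⟨d, hd, h⟩ := this
  exact ⟨_, d, hd, rfl, h⟩

theorem IsHamiltonianCycle.reverse {C : G.Walk u u} (hC : C.IsHamiltonianCycle) :
    C.reverse.IsHamiltonianCycle := by
  have := hC.finite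
  have := Fintype.ofFinite V
  rw [isHamiltonianCycle_iff_isCycle_and_length_eq] at hC ⊢
  exact ⟨hC.1.reverse, by simpa using hC.2⟩

theorem IsHamiltonianCycle.exists_hasDart_right {C : G.Walk u u} (hC : C.IsHamiltonianCycle)
    (x : V) : ∃ y, C.HasDart x y := by
  simpa [hasDart_reverse] using hC.reverse.exists_hasDart_left x

theorem hasDart_rotate {C : G.Walk u u} (hv : v ∈ C.support) :
    (C.rotate v hv).HasDart x y ↔ C.HasDart x y := by
  simp only [HasDart, (C.rotate_darts v hv).mem_iff]

/-- Some edge of a Hamiltonian cycle leaves a given proper nonempty set of vertices. -/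
theorem IsHamiltonianCycle.exists_boundary_hasDart {C : G.Walk u u} (hC : C.IsHamiltonianCycle)
    (s : Set V) (hx : x ∈ s) (hy : y ∉ s) : ∃ p ∈ s, ∃ q ∉ s, C.HasDart p q := by
  have hx' := hC.mem_support x
  obtain ⟨d, hd, h1, h2⟩ := ((C.rotate x hx').takeUntil y
    ((hC.rotate hx').mem_support y)).exists_boundary_dart s hx hy
  exact ⟨_, h1, _, h2, (hasDart_rotate hx').1 ⟨d, darts_takeUntil_subset_darts _ _ hd, rfl, rfl⟩⟩

/-- If a Hamiltonian cycle runs through `x y` and `x' y'` in these directions and `y`, `y'`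
are adjacent, exchanging these two edges for `y y'` gives a Hamiltonian path from `x` to `x'`. -/
theorem IsHamiltonianCycle.exists_isHamiltonian_of_adj_snd {C : G.Walk u u}
    (hC : C.IsHamiltonianCycle) {x' y' : V} (hxy : C.HasDart x y) (hxy' : C.HasDart x' y')
    (hadj : G.Adj y y') : ∃ p : G.Walk x x', p.IsHamiltonian := by
  have hx := hC.mem_support x
  have hD := hC.rotate hx
  rw [← hasDart_rotate hx] at hxy hxy'
  generalize C.rotate x hx = D at hD hxy hxy'
  cases D with
  | nil => exact absurd rfl hD.ne_nil
  | @cons _ c _ h p =>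
    obtain rfl : c = y := hD.isCycle.hasDart_right_unique ⟨⟨(x, c), h⟩, by simp, rfl, rfl⟩ hxy
    have hp : p.IsHamiltonian := by
      have := hD.isHamiltonian_tail
      intro z
      rw [← this z, support_tail_of_not_nil _ (by simp)]
      simp
    have hne : x' ≠ x := by
      rintro rfl
      exact hadj.ne (hD.isCycle.hasDart_right_unique hxy hxy')
    obtain ⟨d, hd, rfl, rfl⟩ := hxy'
    rw [darts_cons, List.mem_cons] at hd
    rcases hd with rfl | hd
    · exact absurd rfl hne
    obtain ⟨q, r, rfl⟩ := p.exists_eq_append_cons_of_mem_darts hd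
    refine ⟨r.reverse.append (cons hadj.symm q), fun z => ?_⟩
    have := hp z
    simp only [support_append, support_cons, List.tail_cons, List.count_append,
      support_reverse, List.count_reverse] at this ⊢
    lia

/-- If a Hamiltonian cycle runs through `x y` and `x' y'` in these directions and `x`, `x'`
are adjacent, exchanging these two edges for `x x'` gives a Hamiltonian path from `y` to `y'`. -/
theorem IsHamiltonianCycle.exists_isHamiltonian_of_adj_fst {C : G.Walk u u}
    (hC : C.IsHamiltonianCycle) {x' y' : V} (hxy : C.HasDart x y) (hxy' : C.HasDart x' y')
    (hadj : G.Adj x x') : ∃ p : G.Walk y y', p.IsHamiltonian :=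
  hC.reverse.exists_isHamiltonian_of_adj_snd (hasDart_reverse.2 hxy) (hasDart_reverse.2 hxy') hadj

/-- At a vertex with just three neighbours a Hamiltonian cycle omits exactly one edge. -/
theorem IsHamiltonianCycle.mem_edges_of_three_neighbors {C : G.Walk u u}
    (hC : C.IsHamiltonianCycle) {p q r : V} (hN : ∀ y, G.Adj x y → y = p ∨ y = q ∨ y = r)
    (hpq : p ≠ q) (hpr : p ≠ r) (hqr : q ≠ r) :
    (s(x, r) ∉ C.edges → s(x, p) ∈ C.edges ∧ s(x, q) ∈ C.edges) ∧
      (s(x, r) ∈ C.edges → (s(x, p) ∈ C.edges ↔ s(x, q) ∉ C.edges)) := by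
  simp only [mem_edges_iff_hasDart]
  obtain ⟨y, hy⟩ := hC.exists_hasDart_left x
  obtain ⟨z, hz⟩ := hC.exists_hasDart_right x
  have hin : ∀ t, C.HasDart t x ↔ t = y :=
    fun t => ⟨fun h => hC.isCycle.hasDart_left_unique h hy, fun h => h ▸ hy⟩
  have hout : ∀ t, C.HasDart x t ↔ t = z :=
    fun t => ⟨fun h => hC.isCycle.hasDart_right_unique h hz, fun h => h ▸ hz⟩
  have hyz : y ≠ z := by
    rintro rfl
    exact hC.isCycle.isTrail.not_hasDart_swap hy hz
  have h1 := hN y hy.adj.symm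
  have h2 := hN z hz.adj
  simp only [hin, hout]
  grind

/-- If no Hamiltonian path joins `y` and `y'`, while a Hamiltonian cycle contains `x y` and
`x' y'` with `x`, `x'` adjacent, then the cycle traverses these edges in opposite directions. -/
theorem IsHamiltonianCycle.hasDart_iff_not_of_adj {C : G.Walk u u} (hC : C.IsHamiltonianCycle)
    {x' y' : V} (hxy : s(x, y) ∈ C.edges) (hxy' : s(x', y') ∈ C.edges) (hadj : G.Adj x x')
    (hno : ¬ ∃ p : G.Walk y y', p.IsHamiltonian) :
    C.HasDart x y ↔ ¬ C.HasDart x' y' := by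
  rw [mem_edges_iff_hasDart] at hxy hxy'
  constructor
  · exact fun h h' => hno (hC.exists_isHamiltonian_of_adj_fst h h' hadj)
  · intro h'
    by_contra h
    exact hno (hC.exists_isHamiltonian_of_adj_snd (hxy.resolve_left h) (hxy'.resolve_left h') hadj)

end SimpleGraph.Walk

/-- Abstract record of a Hamiltonian cycle of an I-graph that is neither 4-hooked nor 2-hooked:
`S i`, `A i`, `B i` say that the cycle contains the spoke at `i`, the outer edge from `i` to
`i + a`, the inner edge from `i` to `i + b`, and `σ i` that it traverses the spoke from `u_i` to `v_i`. -/
structure HookFree {M : Type*} [AddCommGroup M] (a b : M) (S A B σ : M → Prop) : Prop where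
  outer_of_not : ∀ i, ¬ S i → A i ∧ A (i - a)
  outer_of_spoke : ∀ i, S i → (A i ↔ ¬ A (i - a))
  outer_sign : ∀ i, S i → S (i + a) → (σ i ↔ ¬ σ (i + a))
  outer_sign_skip : ∀ i, S (i - a) → ¬ S i → S (i + a) → (σ (i - a) ↔ ¬ σ (i + a))
  inner_of_not : ∀ i, ¬ S i → B i ∧ B (i - b)
  inner_of_spoke : ∀ i, S i → (B i ↔ ¬ B (i - b))
  inner_sign : ∀ i, S i → S (i + b) → (σ i ↔ ¬ σ (i + b))
  inner_sign_skip : ∀ i, S (i - b) → ¬ S i → S (i + b) → (σ (i - b) ↔ ¬ σ (i + b))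
  no_hook : ∀ t, ¬ (A t ∧ A (t + b) ∧ B t ∧ B (t + a))

namespace HookFree

variable {M : Type*} [AddCommGroup M] {a b : M} {S A B σ : M → Prop}

theorem swap (h : HookFree a b S A B σ) : HookFree b a S B A σ where
  outer_of_not := h.inner_of_not
  outer_of_spoke := h.inner_of_spoke
  outer_sign := h.inner_sign
  outer_sign_skip := h.inner_sign_skip
  inner_of_not := h.outer_of_not
  inner_of_spoke := h.outer_of_spoke
  inner_sign := h.outer_sign
  inner_sign_skip := h.outer_sign_skip
  no_hook t := by have := h.no_hook t; tauto

theorem neg_left (h : HookFree a b S A B σ) :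
    HookFree (-a) b S (fun i => A (i - a)) B σ where
  outer_of_not i hi := by
    have := h.outer_of_not i hi
    simpa [and_comm] using this
  outer_of_spoke i hi := by
    have := h.outer_of_spoke i hi
    simp only [sub_neg_eq_add, add_sub_cancel_right]; tauto
  outer_sign i h0 h1 := by
    have := h.outer_sign (i + -a) h1 (by simpa using h0)
    simp only [neg_add_cancel_right] at this; tauto
  outer_sign_skip i h0 h1 h2 := by
    rw [sub_neg_eq_add] at h0 ⊢
    rw [← sub_eq_add_neg] at h2 ⊢
    have := h.outer_sign_skip i h2 h1 h0
    tauto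
  inner_of_not := h.inner_of_not
  inner_of_spoke := h.inner_of_spoke
  inner_sign := h.inner_sign
  inner_sign_skip := h.inner_sign_skip
  no_hook t := by
    have := h.no_hook (t - a)
    rw [sub_add_cancel, sub_add_eq_add_sub] at this
    rw [← sub_eq_add_neg]
    tauto

theorem neg_right (h : HookFree a b S A B σ) :
    HookFree a (-b) S A (fun i => B (i - b)) σ :=
  h.swap.neg_left.swap

theorem not_inner_edge (h : HookFree a b S A B σ) {i : M} (h0 : ¬ S i) (h1 : S (i + a)) :
    ¬ B (i + a) := by
  intro hB
  have hA0 := h.outer_of_not i h0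
  have hB0 := h.inner_of_not i h0
  have hAb : ¬ A (i + b) := fun hA => h.no_hook i ⟨hA0.1, hA, hB0.1, hB⟩
  have hSb : S (i + b) := by
    by_contra hS; exact hAb (h.outer_of_not _ hS).1
  have hSab : S (i + b + a) := by
    by_contra hS
    have := (h.outer_of_not _ hS).2
    rw [add_sub_cancel_right] at this; exact hAb this
  have hAl : A (i + b - a) := by
    by_contra hA; exact hAb ((h.outer_of_spoke _ hSb).2 hA)
  have hBl : ¬ B (i - a) := fun hB' => by
    refine h.no_hook (i - a) ⟨hA0.2, ?_, hB', ?_⟩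
    · rwa [sub_add_eq_add_sub]
    · rw [sub_add_cancel]; exact hB0.1
  have hSl : S (i - a) := by
    by_contra hS; exact hBl (h.inner_of_not _ hS).1
  have hSlb : S (i - a + b) := by
    by_contra hS
    have := (h.inner_of_not _ hS).2
    rw [add_sub_cancel_right] at this; exact hBl this
  have e1 := h.outer_sign_skip i hSl h0 h1
  have e2 := h.inner_sign (i + a) h1 (by rwa [add_right_comm])
  have e3 := h.outer_sign (i + b) hSb hSab
  have e4 := h.inner_sign (i - a) hSl hSlb
  have e5 := h.outer_sign (i - a + b) hSlb (by rwa [add_right_comm, sub_add_cancel])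
  rw [add_right_comm, sub_add_cancel] at e5
  rw [add_right_comm] at e2
  tauto

theorem not_spoke_add_left (h : HookFree a b S A B σ) {i : M} (h0 : ¬ S i) : ¬ S (i + a) := by
  intro h1
  have h2 := h.not_inner_edge h0 h1
  have h3 := h.neg_right.not_inner_edge h0 h1
  have := h.inner_of_spoke _ h1
  tauto

theorem not_spoke_sub_left (h : HookFree a b S A B σ) {i : M} (h0 : ¬ S i) : ¬ S (i - a) := by
  rw [sub_eq_add_neg]; exact h.neg_left.not_spoke_add_left h0

end HookFree

theorem Igraph_adj_inl {m : ℕ} {a b i : ZMod m} {y : ZMod m ⊕ ZMod m} :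
    (Igraph m a b).Adj (Sum.inl i) y →
      y = Sum.inl (i + a) ∨ y = Sum.inl (i - a) ∨ y = Sum.inr i := by
  rcases y with j | j
  · simp only [Igraph, bicirculant, fromRel_adj, Set.mem_insert_iff, Set.mem_singleton_iff]
    rintro ⟨-, ⟨k, rfl | rfl, h⟩ | ⟨k, rfl | rfl, h⟩⟩ <;> simp [h, sub_eq_add_neg]
  · simp [Igraph, bicirculant]

theorem Igraph_adj_inr {m : ℕ} {a b i : ZMod m} {y : ZMod m ⊕ ZMod m} :
    (Igraph m a b).Adj (Sum.inr i) y →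
      y = Sum.inr (i + b) ∨ y = Sum.inr (i - b) ∨ y = Sum.inl i := by
  rcases y with j | j
  · simp [Igraph, bicirculant, eq_comm]
  · simp only [Igraph, bicirculant, fromRel_adj, Set.mem_insert_iff, Set.mem_singleton_iff]
    rintro ⟨-, ⟨k, rfl | rfl, h⟩ | ⟨k, rfl | rfl, h⟩⟩ <;> simp [h, sub_eq_add_neg]

theorem Igraph_adj_inl_add {m : ℕ} {a b : ZMod m} (ha : a ≠ 0) (i : ZMod m) :
    (Igraph m a b).Adj (Sum.inl i) (Sum.inl (i + a)) := by
  simp [Igraph, bicirculant, ha]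

theorem Igraph_adj_inr_add {m : ℕ} {a b : ZMod m} (hb : b ≠ 0) (i : ZMod m) :
    (Igraph m a b).Adj (Sum.inr i) (Sum.inr (i + b)) := by
  simp [Igraph, bicirculant, hb]

theorem ZMod.add_ne_sub_of_two_mul_ne_zero {m : ℕ} {a : ZMod m} (ha2 : 2 * a ≠ 0) (i : ZMod m) :
    i + a ≠ i - a := fun h => ha2 (by linear_combination h)

/-- A Hamiltonian cycle of an I-graph that is neither 4-hooked nor 2-hooked is hook-free. -/
theorem HookFree.of_isHamiltonianCycle {m : ℕ} {a b : ZMod m} (ha : a ≠ 0) (hb : b ≠ 0)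
    (ha2 : 2 * a ≠ 0) (hb2 : 2 * b ≠ 0) {w : ZMod m ⊕ ZMod m} {C : (Igraph m a b).Walk w w}
    (hC : C.IsHamiltonianCycle)
    (h4 : ¬ ∃ t : ZMod m,
      s(Sum.inl t, Sum.inl (t + a)) ∈ C.edges ∧
      s(Sum.inl (t + b), Sum.inl (t + a + b)) ∈ C.edges ∧
      s(Sum.inr t, Sum.inr (t + b)) ∈ C.edges ∧
      s(Sum.inr (t + a), Sum.inr (t + a + b)) ∈ C.edges)
    (h2 : ¬ ∃ t : ZMod m,
      (∃ p : (Igraph m a b).Walk (Sum.inr t) (Sum.inr (t + a)), p.IsHamiltonian) ∨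
      (∃ p : (Igraph m a b).Walk (Sum.inl t) (Sum.inl (t + b)), p.IsHamiltonian)) :
    HookFree a b (fun i => s(Sum.inl i, Sum.inr i) ∈ C.edges)
      (fun i => s(Sum.inl i, Sum.inl (i + a)) ∈ C.edges)
      (fun i => s(Sum.inr i, Sum.inr (i + b)) ∈ C.edges)
      (fun i => C.HasDart (Sum.inl i) (Sum.inr i)) := by
  have outer (i) := hC.mem_edges_of_three_neighbors (fun _ => Igraph_adj_inl (i := i))
    (by simpa using ZMod.add_ne_sub_of_two_mul_ne_zero ha2 i) (by simp) (by simp)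
  have inner (i) := hC.mem_edges_of_three_neighbors (fun _ => Igraph_adj_inr (i := i))
    (by simpa using ZMod.add_ne_sub_of_two_mul_ne_zero hb2 i) (by simp) (by simp)
  simp only [Sym2.eq_swap (a := Sum.inr _) (b := Sum.inl _)] at inner
  have swapU (i : ZMod m) : s((Sum.inl (i - a) : ZMod m ⊕ ZMod m), Sum.inl i) ∈ C.edges ↔
      s(Sum.inl i, Sum.inl (i - a)) ∈ C.edges := by rw [Sym2.eq_swap]
  have swapV (i : ZMod m) : s((Sum.inr (i - b) : ZMod m ⊕ ZMod m), Sum.inr i) ∈ C.edges ↔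
      s(Sum.inr i, Sum.inr (i - b)) ∈ C.edges := by rw [Sym2.eq_swap]
  have sign (i : ZMod m) (hi : s(Sum.inl i, Sum.inr i) ∈ C.edges) :=
    hC.isCycle.isTrail.hasDart_iff_not_swap hi
  push Not at h2 h4
  refine ⟨fun i hi => ?_, fun i hi => ?_, fun i h0 h1 => ?_, fun i h0 hi h1 => ?_,
    fun i hi => ?_, fun i hi => ?_, fun i h0 h1 => ?_, fun i h0 hi h1 => ?_, fun t ht => ?_⟩
  · simpa [swapU] using (outer i).1 hi
  · simpa [swapU] using (outer i).2 hi
  · exact hC.hasDart_iff_not_of_adj h0 h1 (Igraph_adj_inl_add ha i) (by simpa using (h2 i).1)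
  · have := (outer i).1 hi
    exact hC.isCycle.hasDart_iff_not_of_mem_edges h0 h1 this.2 this.1
      (by simpa using (ZMod.add_ne_sub_of_two_mul_ne_zero ha2 i).symm) (by simp) (by simp)
  · simpa [swapV] using (inner i).1 hi
  · simpa [swapV] using (inner i).2 hi
  · rw [sign _ h0, sign _ h1]
    exact not_congr <| hC.hasDart_iff_not_of_adj (by rwa [Sym2.eq_swap]) (by rwa [Sym2.eq_swap])
      (Igraph_adj_inr_add hb i) (by simpa using (h2 i).2)
  · have := (inner i).1 hi
    rw [sign _ h0, sign _ h1]
    exact not_congr <| hC.isCycle.hasDart_iff_not_of_mem_edges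
      (by rwa [Sym2.eq_swap]) (by rwa [Sym2.eq_swap]) this.2 this.1
      (by simpa using (ZMod.add_ne_sub_of_two_mul_ne_zero hb2 i).symm) (by simp) (by simp)
  · obtain ⟨h5, h6, h7, h8⟩ := ht
    rw [add_right_comm] at h6
    exact h4 t h5 h6 h7 h8

/-- Every Hamilton cycle of a connected I-graph `I(m;a,b)` with `a ≠ ±b` is
alternating, 4-hooked or 2-hooked. -/
theorem Igraph_hamilton_cycle_classification (m : ℕ) [NeZero m] (hm : 3 ≤ m) (a b : ZMod m)
    (ha : a ≠ 0) (hb : b ≠ 0) (ha2 : 2 * a ≠ 0) (hb2 : 2 * b ≠ 0)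
    (hab : a ≠ b) (hab' : a ≠ -b) (hconn : (Igraph m a b).Connected)
    (w : ZMod m ⊕ ZMod m) (C : (Igraph m a b).Walk w w) (hC : C.IsHamiltonianCycle) :
    -- (i) `C` is alternating: it contains every spoke `u_i v_i`
    (∀ i : ZMod m, s(Sum.inl i, Sum.inr i) ∈ C.edges) ∨
    -- (ii) `C` is 4-hooked
    (∃ t : ZMod m,
      s(Sum.inl t, Sum.inl (t + a)) ∈ C.edges ∧
      s(Sum.inl (t + b), Sum.inl (t + a + b)) ∈ C.edges ∧
      s(Sum.inr t, Sum.inr (t + b)) ∈ C.edges ∧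
      s(Sum.inr (t + a), Sum.inr (t + a + b)) ∈ C.edges) ∨
    -- (iii) `C` is 2-hooked
    (∃ t : ZMod m,
      (∃ p : (Igraph m a b).Walk (Sum.inr t) (Sum.inr (t + a)), p.IsHamiltonian) ∨
      (∃ p : (Igraph m a b).Walk (Sum.inl t) (Sum.inl (t + b)), p.IsHamiltonian)) := by
  by_contra! hcon
  obtain ⟨⟨i, hi⟩, h4, h2⟩ := hcon
  have hF : HookFree a b _ _ _ _ := HookFree.of_isHamiltonianCycle ha hb ha2 hb2 hC
    (by push Not; exact h4) (by push Not; exact h2)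
  have hnone : ∀ j, s(Sum.inl j, Sum.inr j) ∉ C.edges := by
    by_contra! hj
    obtain ⟨j, hj⟩ := hj
    let f : ZMod m ⊕ ZMod m → ZMod m := Sum.elim id id
    obtain ⟨p⟩ := hconn.preconnected (Sum.inl i) (Sum.inl j)
    obtain ⟨⟨⟨x, y⟩, hxy⟩, -, h1, h2⟩ := p.exists_boundary_dart
      {x | s(Sum.inl (f x), Sum.inr (f x)) ∉ C.edges} hi (by simpa [f] using hj)
    simp only [Set.mem_ofPred_eq] at h1 h2
    refine h2 ?_
    rcases x with x | x
    · rcases Igraph_adj_inl hxy with rfl | rfl | rfl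
      · exact hF.not_spoke_add_left h1
      · exact hF.not_spoke_sub_left h1
      · exact h1
    · rcases Igraph_adj_inr hxy with rfl | rfl | rfl
      · exact hF.swap.not_spoke_add_left h1
      · exact hF.swap.not_spoke_sub_left h1
      · exact h1
  obtain ⟨_, ⟨k, rfl⟩, y, hy, hky⟩ := hC.exists_boundary_hasDart (Set.range Sum.inl)
    (Set.mem_range_self i) (y := Sum.inr i) (by simp)
  rcases Igraph_adj_inl hky.adj with rfl | rfl | rfl
  · simp at hy
  · simp at hy
  · exact hnone k (Walk.mem_edges_iff_hasDart.2 (Or.inl hky))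
end

section
/- Let G = R(m;a,b,c) be a connected generalized rose window graph (m ≥ 3, a, b, c ∈ ZMod m nonzero, 2a ≠ 0, 2b ≠ 0, gcd(m,a,b,c) = 1). Let H be the spanning subgraph of G obtained by deleting all spokes of type c (the edges u_i v_{i+c}, i ∈ ZMod m), and let H_0 denote the induced subgraph of H on the connected component of H containing the vertex u_0. Suppose gcd(m,a,b) > 1 (gcd of m with the canonical integer representatives of a and b). If H_0 has a Hamilton cycle that contains the spoke u_x v_x for every vertex u_x of H_0 (an alternating Hamilton cycle), then G is Hamiltonian. -/
open SimpleGraph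

/-- The generalized rose window graph `R(m;a,b,c) = B(m;{a,-a},{0,c},{b,-b})`. -/
def roseWindow (m : ℕ) (a b c : ZMod m) : SimpleGraph (ZMod m ⊕ ZMod m) :=
  bicirculant m {a, -a} {0, c} {b, -b}

/-- `H`: the spanning subgraph of `R(m;a,b,c)` obtained by deleting the spokes of
type `c`, i.e. all edges `u_i v_{i+c}`. -/
def rwH (m : ℕ) (a b c : ZMod m) : SimpleGraph (ZMod m ⊕ ZMod m) :=
  (roseWindow m a b c).deleteEdges
    {e | ∃ i : ZMod m, e = s(Sum.inl i, Sum.inr (i + c))}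

/-- The vertex set of the connected component of `H` containing `u_0`. -/
def rwK (m : ℕ) (a b c : ZMod m) : Set (ZMod m ⊕ ZMod m) :=
  ((rwH m a b c).connectedComponentMk (Sum.inl 0)).supp

/-- `H_0`: the induced subgraph of `H` on the connected component of `u_0`. -/
def rwH0 (m : ℕ) (a b c : ZMod m) : SimpleGraph (rwK m a b c) :=
  (rwH m a b c).induce (rwK m a b c)

/-- Replacing every edge of a walk by a walk in another graph. -/
theorem SimpleGraph.Walk.exists_expand {V W : Type*} {G : SimpleGraph V} {G' : SimpleGraph W}
    (φ : V → W) (seg : ∀ e : G.Dart, G'.Walk (φ e.fst) (φ e.snd)) {u v : V} (p : G.Walk u v) :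
    ∃ q : G'.Walk (φ u) (φ v),
      q.support.tail = p.darts.flatMap (fun e => (seg e).support.tail) := by
  induction p with
  | nil => exact ⟨.nil, by simp⟩
  | cons h p ih =>
    obtain ⟨q, hq⟩ := ih
    exact ⟨(seg ⟨(_, _), h⟩).append q, by simp [Walk.tail_support_append, hq]⟩

/-- A closed walk of length at least three visiting each vertex exactly once (apart from the
coincidence of its ends) is a Hamiltonian cycle. -/
theorem SimpleGraph.Walk.isHamiltonianCycle_of_nodup {V : Type*} [DecidableEq V]
    {G : SimpleGraph V} {u : V} (p : G.Walk u u) (hlen : 3 ≤ p.length)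
    (hnodup : p.support.tail.Nodup) (hmem : ∀ v, v ∈ p.support.tail) :
    p.IsHamiltonianCycle := by
  have hnil : ¬ p.Nil := by
    intro h
    have := Walk.length_eq_zero_iff.2 h
    omega
  rw [Walk.isHamiltonianCycle_iff_isCycle_and_support_count_tail_eq_one]
  refine ⟨Walk.isCycle_iff_isPath_tail_and_le_length.2 ⟨?_, hlen⟩,
    fun v => List.count_eq_one_of_mem hnodup (hmem v)⟩
  rw [Walk.isPath_def, Walk.support_tail_of_not_nil _ hnil]
  exact hnodup

section Adjacency

variable {m : ℕ} {a b c : ZMod m}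

theorem roseWindow_adj_inl_inl {x y : ZMod m} :
    (roseWindow m a b c).Adj (.inl x) (.inl y) ↔ x ≠ y ∧ (y = x + a ∨ y = x - a) := by
  simp only [roseWindow, bicirculant, fromRel_adj, Set.mem_insert_iff, Set.mem_singleton_iff,
    exists_eq_or_imp, exists_eq_left, ne_eq, Sum.inl.injEq]
  grind

theorem roseWindow_adj_inr_inr {x y : ZMod m} :
    (roseWindow m a b c).Adj (.inr x) (.inr y) ↔ x ≠ y ∧ (y = x + b ∨ y = x - b) := by
  simp only [roseWindow, bicirculant, fromRel_adj, Set.mem_insert_iff, Set.mem_singleton_iff,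
    exists_eq_or_imp, exists_eq_left, ne_eq, Sum.inr.injEq]
  grind

theorem roseWindow_adj_inl_inr {x y : ZMod m} :
    (roseWindow m a b c).Adj (.inl x) (.inr y) ↔ y = x ∨ y = x + c := by
  simp [roseWindow, bicirculant]

theorem rwH_adj_inl_inl {x y : ZMod m} :
    (rwH m a b c).Adj (.inl x) (.inl y) ↔ x ≠ y ∧ (y = x + a ∨ y = x - a) := by
  simp [rwH, roseWindow_adj_inl_inl]

theorem rwH_adj_inr_inr {x y : ZMod m} :
    (rwH m a b c).Adj (.inr x) (.inr y) ↔ x ≠ y ∧ (y = x + b ∨ y = x - b) := by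
  simp [rwH, roseWindow_adj_inr_inr]

theorem rwH_adj_inl_inr (hc : c ≠ 0) {x y : ZMod m} :
    (rwH m a b c).Adj (.inl x) (.inr y) ↔ y = x := by
  simp only [rwH, deleteEdges_adj, roseWindow_adj_inl_inr, Set.mem_ofPred_eq, Sym2.eq_iff]
  constructor
  · rintro ⟨h | h, h'⟩
    · exact h
    · exact absurd ⟨x, by simp [h]⟩ h'
  · rintro rfl
    simp [hc]

/-- The index of a vertex in `ZMod m`. -/
def vertexIndex (p : ZMod m ⊕ ZMod m) : ZMod m := Sum.elim id id p

theorem rwH_adj_vertexIndex (hc : c ≠ 0) {p q : ZMod m ⊕ ZMod m} (h : (rwH m a b c).Adj p q) :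
    vertexIndex q - vertexIndex p ∈ AddSubgroup.closure {a, b} := by
  have hA : a ∈ AddSubgroup.closure {a, b} := AddSubgroup.subset_closure (by simp)
  have hB : b ∈ AddSubgroup.closure {a, b} := AddSubgroup.subset_closure (by simp)
  rcases p with x | x <;> rcases q with y | y
  · rcases (rwH_adj_inl_inl.1 h).2 with rfl | rfl <;> simp [vertexIndex, hA]
  · simp [vertexIndex, (rwH_adj_inl_inr hc).1 h]
  · simp [vertexIndex, (rwH_adj_inl_inr hc).1 h.symm]
  · rcases (rwH_adj_inr_inr.1 h).2 with rfl | rfl <;> simp [vertexIndex, hB]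

/-- Rim translations preserve the component of a vertex `u_x` of `H`. -/
theorem rwH_reachable_inl_add (ha : a ≠ 0) (hb : b ≠ 0) (hc : c ≠ 0) {g : ZMod m}
    (hg : g ∈ AddSubgroup.closure {a, b}) :
    ∀ x, (rwH m a b c).Reachable (.inl x) (.inl (x + g)) := by
  induction hg using AddSubgroup.closure_induction with
  | mem g hg =>
    intro x
    rcases hg with rfl | rfl
    · exact (rwH_adj_inl_inl.2 ⟨by simpa using ha, .inl rfl⟩).reachable
    · have h1 : (rwH m a g c).Adj (.inl x) (.inr x) := (rwH_adj_inl_inr hc).2 rfl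
      have h2 : (rwH m a g c).Adj (.inr x) (.inr (x + g)) :=
        rwH_adj_inr_inr.2 ⟨by simpa using hb, .inl rfl⟩
      have h3 : (rwH m a g c).Adj (.inl (x + g)) (.inr (x + g)) := (rwH_adj_inl_inr hc).2 rfl
      exact (h1.reachable.trans h2.reachable).trans h3.reachable.symm
  | zero => intro x; simp
  | add g g' _ _ ih ih' =>
    intro x
    rw [← add_assoc]
    exact (ih x).trans (ih' _)
  | neg g _ ih =>
    intro x
    simpa using (ih (x + -g)).symm

theorem mem_rwK_iff (ha : a ≠ 0) (hb : b ≠ 0) (hc : c ≠ 0) {p : ZMod m ⊕ ZMod m} :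
    p ∈ rwK m a b c ↔ vertexIndex p ∈ AddSubgroup.closure {a, b} := by
  have hK : p ∈ rwK m a b c ↔ (rwH m a b c).Reachable p (.inl 0) := by
    simp [rwK, ConnectedComponent.mem_supp_iff, ConnectedComponent.eq]
  rw [hK]
  constructor
  · rintro ⟨w⟩
    have key : ∀ {p q : ZMod m ⊕ ZMod m}, (rwH m a b c).Walk p q →
        vertexIndex q - vertexIndex p ∈ AddSubgroup.closure {a, b} := by
      intro p q w
      induction w with
      | nil => simp
      | cons h _ ih => simpa using add_mem ih (rwH_adj_vertexIndex hc h)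
    simpa [vertexIndex] using key w
  · intro h
    have h0 : (rwH m a b c).Reachable (.inl (vertexIndex p)) (.inl 0) := by
      simpa using (rwH_reachable_inl_add ha hb hc h 0).symm
    rcases p with x | x
    · exact h0
    · exact ((rwH_adj_inl_inr (x := x) hc).2 rfl).symm.reachable.trans h0

/-- Alternating spokes of type `c` and of type `0` form a path from `u_x` to `v_{x+(k+1)c}`. -/
theorem exists_spoke_path (x : ZMod m) (k : ℕ)
    (hk : ∀ i, 0 < i → i ≤ k → i • c ≠ 0) :
    ∃ P : (roseWindow m a b c).Walk (.inl x) (.inr (x + (k + 1) • c)),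
      P.IsPath ∧ ∀ p, p ∈ P.support ↔ p = .inl x ∨ p = .inr (x + (k + 1) • c) ∨
        ∃ j, 0 < j ∧ j < k + 1 ∧ (p = .inl (x + j • c) ∨ p = .inr (x + j • c)) := by
  have hinj : ∀ i j, i < j → j ≤ i + k → i • c ≠ j • c := by
    intro i j hij hjk h
    refine hk (j - i) (by omega) (by omega) ?_
    rw [sub_nsmul _ hij.le, h, add_neg_cancel]
  induction k with
  | zero =>
    refine ⟨Walk.cons (roseWindow_adj_inl_inr.2 (.inr (by simp))) .nil, by simp, ?_⟩
    intro p
    simp only [Walk.support_cons, Walk.support_nil, List.mem_cons, List.not_mem_nil, or_false]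
    constructor
    · tauto
    · rintro (h | h | ⟨j, h0, h1, -⟩)
      · exact .inl h
      · exact .inr h
      · omega
  | succ k ih =>
    obtain ⟨P, hP, hsupp⟩ := ih (fun i h0 hi => hk i h0 (by omega))
      (fun i j hij hj => hinj i j hij (by omega))
    have e1 : (roseWindow m a b c).Adj (.inr (x + (k + 1) • c)) (.inl (x + (k + 1) • c)) :=
      (roseWindow_adj_inl_inr.2 (.inl rfl)).symm
    have e2 : (roseWindow m a b c).Adj (.inl (x + (k + 1) • c)) (.inr (x + (k + 1 + 1) • c)) :=
      roseWindow_adj_inl_inr.2 (.inr (by rw [succ_nsmul c (k + 1), add_assoc]))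
    refine ⟨(P.concat e1).concat e2, ?_, ?_⟩
    · refine (hP.concat ?_ e1).concat ?_ e2
      · rw [hsupp]
        rintro (h | h | ⟨j, h0, h1, h | h⟩)
        · exact hk (k + 1) (by omega) le_rfl (by simpa using h)
        · cases h
        · exact hinj j (k + 1) h1 (by omega) (by simpa using h.symm)
        · cases h
      · rw [Walk.support_concat, List.mem_append, hsupp]
        rintro ((h | h | ⟨j, h0, h1, h | h⟩) | h)
        · cases h
        · exact hinj (k + 1) (k + 1 + 1) (by omega) (by omega) (by simpa using h.symm)
        · cases h
        · exact hinj j (k + 1 + 1) (by omega) (by omega) (by simpa using h.symm)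
        · simp at h
    · intro p
      simp only [Walk.support_concat, List.mem_append, hsupp, List.mem_singleton]
      constructor
      · rintro (((h | h | ⟨j, h0, h1, h⟩) | h) | h)
        · exact .inl h
        · exact .inr (.inr ⟨k + 1, by omega, by omega, .inr h⟩)
        · exact .inr (.inr ⟨j, h0, by omega, h⟩)
        · exact .inr (.inr ⟨k + 1, by omega, by omega, .inl h⟩)
        · exact .inr (.inl h)
      · rintro (h | h | ⟨j, h0, h1, h⟩)
        · tauto
        · tauto
        · rcases Nat.lt_succ_iff_lt_or_eq.1 h1 with h2 | rfl
          · exact .inl (.inl (.inr (.inr ⟨j, h0, h2, h⟩)))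
          · tauto

end Adjacency

/-- If `gcd(m,a,b,c) = 1` then `a`, `b`, `c` generate `ZMod m`. -/
theorem ZMod.eq_top_of_gcd_eq_one {m : ℕ} [NeZero m] {a b c : ZMod m}
    (hgcd : Nat.gcd m (Nat.gcd a.val (Nat.gcd b.val c.val)) = 1) (S : AddSubgroup (ZMod m))
    (ha : a ∈ S) (hb : b ∈ S) (hc : c ∈ S) : S = ⊤ := by
  have hg : ∀ p q : ℕ, (p : ZMod m) ∈ S → (q : ZMod m) ∈ S → (Nat.gcd p q : ZMod m) ∈ S := by
    intro p q hp hq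
    have h := congrArg (Int.cast : ℤ → ZMod m) (Nat.gcd_eq_gcd_ab p q)
    push_cast at h
    rw [h, mul_comm (p : ZMod m), mul_comm (q : ZMod m), ← zsmul_eq_mul, ← zsmul_eq_mul]
    exact add_mem (zsmul_mem hp _) (zsmul_mem hq _)
  have h1 : (1 : ZMod m) ∈ S := by
    have := hg m _ (by simp) (hg a.val _ (by simpa using ha) (hg b.val c.val (by simpa using hb)
      (by simpa using hc)))
    rw [hgcd] at this
    simpa using this
  refine (AddSubgroup.eq_top_iff' S).2 fun x => ?_
  have := nsmul_mem h1 x.val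
  simpa using this

/-- Elements of `⟨a, b, c⟩` modulo the subgroup `K`, with `d` the order of `c` modulo `K`. -/
theorem AddSubgroup.exists_add_nsmul_of_sup_zmultiples_eq_top {A : Type*} [AddCommGroup A]
    {K : AddSubgroup A} {c : A} (h : K ⊔ AddSubgroup.zmultiples c = ⊤) {d : ℕ} (hd : 0 < d)
    (hdc : d • c ∈ K) (y : A) : ∃ x ∈ K, ∃ j < d, y = x + j • c := by
  obtain ⟨x, hx, _, ⟨z, rfl⟩, rfl⟩ := AddSubgroup.mem_sup.1 (h ▸ AddSubgroup.mem_top y)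
  have hz0 := Int.emod_nonneg z (b := d) (by omega)
  have hz1 := Int.emod_lt_of_pos z (b := d) (by omega)
  refine ⟨x + (z / d) • (d • c), add_mem hx (zsmul_mem hdc _), (z % d).toNat, by omega, ?_⟩
  have : ((z % d).toNat : ℤ) • c = (z % d) • c := by rw [Int.toNat_of_nonneg hz0]
  rw [natCast_zsmul] at this
  rw [this, add_assoc, ← natCast_zsmul c d, smul_smul, ← add_smul, Int.ediv_mul_add_emod]

section Expansion

variable {m : ℕ} {a b c : ZMod m}

/-- The rim translation `u_x ↦ u_x`, `v_x ↦ v_{x+t}`. -/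
def shiftRight (t : ZMod m) (p : ZMod m ⊕ ZMod m) : ZMod m ⊕ ZMod m := Sum.map id (· + t) p

theorem shiftRight_injective (t : ZMod m) : Function.Injective (shiftRight t) :=
  Sum.map_injective.2 ⟨Function.injective_id, add_left_injective t⟩

/-- The path of `R(m;a,b,c)` that replaces an edge of `H`: a translate for a rim edge, and an
alternating path of spokes for a spoke. -/
theorem exists_replacement_path (hc : c ≠ 0) {d : ℕ} (hd : 0 < d)
    (hmin : ∀ i, 0 < i → i < d → i • c ≠ 0) {p q : ZMod m ⊕ ZMod m}
    (h : (rwH m a b c).Adj p q) :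
    ∃ P : (roseWindow m a b c).Walk (shiftRight (d • c) p) (shiftRight (d • c) q),
      P.IsPath ∧ ∀ r, r ∈ P.support ↔ r = shiftRight (d • c) p ∨ r = shiftRight (d • c) q ∨
        ∃ x j, s(p, q) = s(.inl x, .inr x) ∧ 0 < j ∧ j < d ∧
          (r = .inl (x + j • c) ∨ r = .inr (x + j • c)) := by
  have hspoke : ∀ x, ∃ P : (roseWindow m a b c).Walk (shiftRight (d • c) (.inl x))
      (shiftRight (d • c) (.inr x)), P.IsPath ∧
        ∀ r, r ∈ P.support ↔ r = shiftRight (d • c) (.inl x) ∨ r = shiftRight (d • c) (.inr x) ∨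
          ∃ j, 0 < j ∧ j < d ∧ (r = .inl (x + j • c) ∨ r = .inr (x + j • c)) := by
    intro x
    obtain ⟨k, rfl⟩ : ∃ k, d = k + 1 := ⟨d - 1, by omega⟩
    exact exists_spoke_path x k (fun i h0 hi => hmin i h0 (by omega))
  rcases p with x | x <;> rcases q with y | y
  · have h' : (roseWindow m a b c).Adj (shiftRight (d • c) (.inl x))
        (shiftRight (d • c) (.inl y)) :=
      roseWindow_adj_inl_inl.2 (rwH_adj_inl_inl.1 h)
    exact ⟨h'.toWalk, by simpa using h'.ne, by simp⟩
  · obtain rfl := (rwH_adj_inl_inr hc).1 h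
    obtain ⟨P, hP, hsupp⟩ := hspoke y
    refine ⟨P, hP, fun r => ?_⟩
    simp [hsupp]
  · obtain rfl := (rwH_adj_inl_inr hc).1 h.symm
    obtain ⟨P, hP, hsupp⟩ := hspoke x
    refine ⟨P.reverse, hP.reverse, fun r => ?_⟩
    simp [hsupp, or_left_comm]
  · have h' : (roseWindow m a b c).Adj (shiftRight (d • c) (.inr x))
        (shiftRight (d • c) (.inr y)) := by
      refine roseWindow_adj_inr_inr.2 ?_
      obtain ⟨h1, h2⟩ := rwH_adj_inr_inr.1 h
      refine ⟨by simpa using h1, ?_⟩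
      rcases h2 with rfl | rfl
      · left; simp only; ring
      · right; simp only; ring
    exact ⟨h'.toWalk, by simpa using h'.ne, by simp⟩

end Expansion

/-- The alternating construction: if `gcd(m,a,b) > 1` and `H_0` has an alternating
Hamilton cycle (one containing the spoke `u_x v_x` for every vertex `u_x` of `H_0`),
then the connected generalized rose window graph `R(m;a,b,c)` is hamiltonian. -/
theorem roseWindow_alternating_construction (m : ℕ) [NeZero m] (hm : 3 ≤ m)
    (a b c : ZMod m) (ha : a ≠ 0) (hb : b ≠ 0) (hc : c ≠ 0)
    (ha2 : 2 * a ≠ 0) (hb2 : 2 * b ≠ 0)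
    (hgcd : Nat.gcd m (Nat.gcd a.val (Nat.gcd b.val c.val)) = 1)
    (hgcd2 : 1 < Nat.gcd m (Nat.gcd a.val b.val))
    (halt : ∃ (w : rwK m a b c) (C : (rwH0 m a b c).Walk w w),
      C.IsHamiltonianCycle ∧
      ∀ (x : ZMod m) (h1 : Sum.inl x ∈ rwK m a b c),
        ∃ h2 : Sum.inr x ∈ rwK m a b c,
          s((⟨Sum.inl x, h1⟩ : rwK m a b c), (⟨Sum.inr x, h2⟩ : rwK m a b c)) ∈ C.edges) :
    (roseWindow m a b c).IsHamiltonian := by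
  set K := AddSubgroup.closure {a, b} with hK
  have hmem : ∀ {p}, p ∈ rwK m a b c ↔ vertexIndex p ∈ K := mem_rwK_iff ha hb hc
  have hex : ∃ d, 0 < d ∧ d • c ∈ K :=
    ⟨m, NeZero.pos m, by simp⟩
  classical
  obtain ⟨hd, hdc⟩ := Nat.find_spec hex
  have hmin : ∀ i, 0 < i → i < Nat.find hex → i • c ∉ K := fun i h0 hi h =>
    Nat.find_min hex hi ⟨h0, h⟩
  generalize Nat.find hex = d at hd hdc hmin
  have hdecomp : ∀ y, ∃ x ∈ K, ∃ j < d, y = x + j • c := by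
    refine AddSubgroup.exists_add_nsmul_of_sup_zmultiples_eq_top ?_ hd hdc
    refine ZMod.eq_top_of_gcd_eq_one hgcd _ ?_ ?_ ?_
    · exact AddSubgroup.mem_sup_left (AddSubgroup.subset_closure (by simp))
    · exact AddSubgroup.mem_sup_left (AddSubgroup.subset_closure (by simp))
    · exact AddSubgroup.mem_sup_right (AddSubgroup.mem_zmultiples c)
  have hnotMem : ∀ {x j}, x ∈ K → 0 < j → j < d → x + j • c ∉ K := fun hx h0 hj h =>
    hmin _ h0 hj ((K.add_mem_cancel_left hx).1 h)
  have huniq : ∀ {x y i j}, x ∈ K → y ∈ K → i < d → j < d → x + i • c = y + j • c → x = y := by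
    have hle : ∀ {x y i j}, x ∈ K → y ∈ K → i ≤ j → j < d → x + i • c = y + j • c → x = y := by
      intro x y i j hx hy hij hj h
      have h' : x = y + (j - i) • c := by
        rw [sub_nsmul _ hij, ← add_assoc, ← h]; abel
      rcases Nat.eq_zero_or_pos (j - i) with h0 | h0
      · simpa [h0] using h'
      · exact absurd (h' ▸ hx) (hnotMem hy h0 (by omega))
    intro x y i j hx hy hi hj h
    rcases le_total i j with hij | hij
    · exact hle hx hy hij hj h
    · exact (hle hy hx hij hi h.symm).symm
  obtain ⟨w, C, hC, hspokes⟩ := halt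
  let φ : rwK m a b c → ZMod m ⊕ ZMod m := fun p => shiftRight (d • c) p
  have hφ : Function.Injective φ := (shiftRight_injective _).comp Subtype.val_injective
  have hφK : ∀ p, vertexIndex (φ p) ∈ K := by
    rintro ⟨x | x, hx⟩
    · exact hmem.1 hx
    · exact add_mem (hmem.1 hx) hdc
  have hseg : ∀ e : (rwH0 m a b c).Dart, ∃ P : (roseWindow m a b c).Walk (φ e.fst) (φ e.snd),
      P.IsPath ∧ ∀ r, r ∈ P.support ↔ r = φ e.fst ∨ r = φ e.snd ∨
        ∃ x j, s(e.fst.1, e.snd.1) = s(.inl x, .inr x) ∧ 0 < j ∧ j < d ∧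
          (r = .inl (x + j • c) ∨ r = .inr (x + j • c)) := fun e =>
    exists_replacement_path hc hd (fun i h0 hi h => hmin i h0 hi (h ▸ K.zero_mem)) e.adj
  choose seg hpath hsupp using hseg
  have hxK : ∀ {e : (rwH0 m a b c).Dart} {x : ZMod m},
      s(e.fst.1, e.snd.1) = s(.inl x, .inr x) → x ∈ K := by
    intro e x h
    rcases Sym2.eq_iff.1 h with ⟨h, -⟩ | ⟨-, h⟩
    · exact hmem.1 (h ▸ e.fst.2)
    · exact hmem.1 (h ▸ e.snd.2)
  have htail : ∀ e r, r ∈ (seg e).support.tail ↔ r = φ e.snd ∨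
      ∃ x j, s(e.fst.1, e.snd.1) = s(.inl x, .inr x) ∧ 0 < j ∧ j < d ∧
        (r = .inl (x + j • c) ∨ r = .inr (x + j • c)) := by
    intro e r
    have hnd := (hpath e).support_nodup
    have hs := hsupp e r
    rw [← Walk.cons_tail_support, List.nodup_cons] at hnd
    rw [← Walk.cons_tail_support, List.mem_cons] at hs
    constructor
    · intro h
      exact (hs.1 (.inr h)).resolve_left (fun h' => hnd.1 (h' ▸ h))
    · intro h
      refine (hs.2 (.inr h)).resolve_left ?_
      rintro rfl
      rcases h with h | ⟨x, j, he, h0, hj, h | h⟩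
      · exact e.adj.ne (hφ h)
      · exact hnotMem (hxK he) h0 hj (by simpa [h, vertexIndex] using hφK e.fst)
      · exact hnotMem (hxK he) h0 hj (by simpa [h, vertexIndex] using hφK e.fst)
  obtain ⟨q, hq⟩ := C.exists_expand φ seg
  have hnodup : q.support.tail.Nodup := by
    rw [hq, List.nodup_flatMap]
    refine ⟨fun e _ => (hpath e).support_nodup.tail, ?_⟩
    have h1 : C.darts.Pairwise (fun e f => e.snd ≠ f.snd) := by
      have := hC.isCycle.support_nodup
      rw [← Walk.map_snd_darts] at this
      exact List.pairwise_map.1 this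
    have h2 : C.darts.Pairwise (fun e f => e.edge ≠ f.edge) :=
      List.pairwise_map.1 hC.isCycle.edges_nodup
    refine (h1.and h2).imp ?_
    rintro e f ⟨hef, hef'⟩ r he hf
    have hedge : ∀ {x}, s(e.fst.1, e.snd.1) = s(.inl x, .inr x) →
        s(f.fst.1, f.snd.1) ≠ s(.inl x, .inr x) := by
      intro x h h'
      exact hef' (Sym2.map.injective Subtype.val_injective (h.trans h'.symm))
    rcases (htail e r).1 he with rfl | ⟨x, i, hx, hi, hi', hr⟩
    · rcases (htail f _).1 hf with h | ⟨y, j, hy, hj, hj', h | h⟩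
      · exact hef (hφ h)
      · exact hnotMem (hxK hy) hj hj' (by simpa [h, vertexIndex] using hφK e.snd)
      · exact hnotMem (hxK hy) hj hj' (by simpa [h, vertexIndex] using hφK e.snd)
    · have hri : vertexIndex r = x + i • c := by
        rcases hr with rfl | rfl <;> rfl
      rcases (htail f r).1 hf with rfl | ⟨y, j, hy, hj, hj', hr'⟩
      · exact hnotMem (hxK hx) hi hi' (hri ▸ hφK f.snd)
      · have hrj : vertexIndex r = y + j • c := by
          rcases hr' with rfl | rfl <;> rfl
        obtain rfl := huniq (hxK hx) (hxK hy) hi' hj' (hri.symm.trans hrj)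
        exact hedge hx hy
  have hrange : ∀ p, φ p ∈ q.support.tail := by
    intro p
    have hp : p ∈ C.support.tail := by
      rw [← Walk.support_tail_of_not_nil _ hC.isCycle.not_nil]
      exact hC.isHamiltonian_tail.mem_support p
    rw [← Walk.map_snd_darts] at hp
    obtain ⟨e, he, rfl⟩ := List.mem_map.1 hp
    rw [hq]
    exact List.mem_flatMap.2 ⟨e, he, (htail e _).2 (.inl rfl)⟩
  have hinterior : ∀ x j r, x ∈ K → 0 < j → j < d →
      r = .inl (x + j • c) ∨ r = .inr (x + j • c) → r ∈ q.support.tail := by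
    intro x j r hx h0 hj hr
    obtain ⟨h2, he⟩ := hspokes x (hmem.2 hx)
    obtain ⟨e, he, hes⟩ := List.mem_map.1 he
    rw [hq]
    refine List.mem_flatMap.2 ⟨e, he, (htail e _).2 (.inr ⟨x, j, ?_, h0, hj, hr⟩)⟩
    exact congrArg (Sym2.map Subtype.val) hes
  have hall : ∀ r, r ∈ q.support.tail := by
    intro r
    obtain ⟨x, hx, j, hj, hr⟩ := hdecomp (vertexIndex r)
    rcases Nat.eq_zero_or_pos j with rfl | h0
    · have hrK : vertexIndex r ∈ K := by simpa [hr] using hx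
      rcases r with y | y
      · exact hrange ⟨.inl y, hmem.2 hrK⟩
      · have hy : y - d • c ∈ K := sub_mem hrK hdc
        simpa [φ, shiftRight] using hrange ⟨.inr (y - d • c), hmem.2 hy⟩
    · refine hinterior x j r hx h0 hj ?_
      rcases r with y | y
      · exact .inl (congrArg Sum.inl hr)
      · exact .inr (congrArg Sum.inr hr)
  intro _
  refine ⟨_, q, ?_⟩
  have hlen : 3 ≤ q.length := by
    have h1 := (Finset.card_le_card (fun r _ => List.mem_toFinset.2 (hall r) :
      (Finset.univ : Finset (ZMod m ⊕ ZMod m)) ⊆ q.support.tail.toFinset)).trans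
        (List.toFinset_card_le _)
    simp only [Finset.card_univ, Fintype.card_sum, ZMod.card, List.length_tail,
      Walk.length_support] at h1
    omega
  convert q.isHamiltonianCycle_of_nodup hlen hnodup hall
end
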